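/- arXiv:0802.2053 — 3 statements merged into one kernel-verified Lean document; each statement's English description precedes it below -/
import Mathlib

section
/- Let A be a C*-algebra and let E be a norm-closed linear subspace of the continuous dual space A* that is a sub-bimodule for the natural dual actions, i.e., for every a ∈ A and f ∈ E the functionals a·f and f·a again lie in E, where (a·f)(x) = f(xa) and (f·a)(x) = f(ax) for x ∈ A. Then E = { a·f·b : a, b ∈ A, f ∈ E }; that is, for every f ∈ E there exist a, b ∈ A and g ∈ E such that f(x) = g(b x a) for all x ∈ A. -/
open Filter Topology

section CohenFactorization

variable {A : Type*} [NonUnitalCStarAlgebra A] [PartialOrder A] [StarOrderedRing A]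

/-- For `0 ≤ a` and `0 < t`, the element `c = a (t + a)⁻¹`, characterised by `t c + a c = a`. -/
lemma CStarAlgebra.exists_smul_add_mul_eq_self {a : A} (ha : 0 ≤ a) {t : ℝ} (ht : 0 < t) :
    ∃ c : A, ‖c‖ ≤ 1 ∧ Commute a c ∧ (t : ℂ) • c + a * c = a := by
  have hpos : ∀ s ∈ quasispectrum ℝ a, 0 ≤ s := fun s hs ↦
    quasispectrum_nonneg_of_nonneg a ha s hs
  have hsa : IsSelfAdjoint a := .of_nonneg ha
  have hcont : ContinuousOn (fun s : ℝ ↦ s / (t + s)) (quasispectrum ℝ a) :=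
    continuousOn_id.div (by fun_prop) fun s hs ↦ by
      have := hpos s hs
      positivity
  refine ⟨cfcₙ (fun s : ℝ ↦ s / (t + s)) a, ?_, ?_, ?_⟩
  · refine norm_cfcₙ_le fun s hs ↦ ?_
    have := hpos s hs
    rw [Real.norm_of_nonneg (by positivity)]
    exact div_le_one_of_le₀ (by linarith) (by linarith)
  · conv_lhs => rw [← cfcₙ_id' ℝ a]
    exact cfcₙ_commute_cfcₙ _ _ a
  · have hmul : a * cfcₙ (fun s : ℝ ↦ s / (t + s)) a = cfcₙ (fun s : ℝ ↦ s * (s / (t + s))) a := by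
      rw [cfcₙ_mul (fun s : ℝ ↦ s) (fun s : ℝ ↦ s / (t + s)) a (by fun_prop) rfl hcont (by simp),
        cfcₙ_id' ℝ a]
    rw [hmul, Complex.coe_smul, ← cfcₙ_const_mul t _ a hcont (by simp),
      ← cfcₙ_add (a := a) _ _ (by fun_prop) (by simp) (by fun_prop) (by simp)]
    conv_rhs => rw [← cfcₙ_id' ℝ a]
    refine cfcₙ_congr fun s hs ↦ ?_
    have := hpos s hs
    have : t + s ≠ 0 := by positivity
    field_simp

variable {X : Type*} [NormedAddCommGroup X] [NormedSpace ℂ X]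

/-- The inductive step in the proof of `CStarAlgebra.exists_apply_eq_of_approx`. -/
lemma CStarAlgebra.exists_smul_add_apply_eq (π : A →L[ℂ] X →L[ℂ] X)
    (hmul : ∀ a c, Commute a c → π (a * c) = π a ∘L π c)
    (happrox : ∀ x : X, ∀ ε > 0, ∃ e : A, 0 ≤ e ∧ ‖e‖ ≤ 1 ∧ ‖x - π e x‖ ≤ ε)
    (E : Submodule ℂ X) (hEπ : ∀ a, ∀ x ∈ E, π a x ∈ E)
    {a : A} (ha : 0 ≤ a) {x y : X} (hy : y ∈ E) {t : ℝ} (ht : 0 < t)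
    (hxy : (2 * t : ℂ) • y + π a y = x) {δ : ℝ} (hδ : 0 < δ) :
    ∃ b : A, ∃ z : X, 0 ≤ b ∧ z ∈ E ∧ (t : ℂ) • z + π b z = x ∧
      ‖b - a‖ ≤ t ∧ ‖z - y‖ ≤ (1 + ‖π‖) * δ := by
  obtain ⟨e, he, he1, hed⟩ := happrox y δ hδ
  have hb : 0 ≤ a + t • e := add_nonneg ha (smul_nonneg ht.le he)
  obtain ⟨c, hc1, hcomm, hc⟩ := CStarAlgebra.exists_smul_add_mul_eq_self hb ht
  set d := y - π e y with hd
  have hdE : d ∈ E := E.sub_mem hy (hEπ _ _ hy)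
  refine ⟨a + t • e, y + (d - π c d), hb, E.add_mem hy (E.sub_mem hdE (hEπ _ _ hdE)), ?_, ?_, ?_⟩
  · have h1 : (t : ℂ) • π c d + π (a + t • e) (π c d) = π (a + t • e) d := by
      conv_rhs => rw [← hc]
      simp [hmul _ _ hcomm]
    have h2 : π (a + t • e) y = π a y + (t : ℂ) • π e y := by
      rw [← Complex.coe_smul]
      simp
    calc _ = (t : ℂ) • y + π (a + t • e) y + (t : ℂ) • d + π (a + t • e) d
          - ((t : ℂ) • π c d + π (a + t • e) (π c d)) := by
          simp only [map_add (π (a + t • e)), map_sub (π (a + t • e)), smul_add, smul_sub]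
          abel
      _ = x := by
          rw [h1, h2, hd, ← hxy]
          module
  · simpa [norm_smul, abs_of_pos ht] using mul_le_of_le_one_right ht.le he1
  · rw [add_sub_cancel_left]
    have hcd : ‖π c d‖ ≤ ‖π‖ * ‖d‖ :=
      (π c).le_of_opNorm_le (π.le_of_opNorm_le_of_le le_rfl hc1 |>.trans (by simp)) d
    calc ‖d - π c d‖ ≤ ‖d‖ + ‖π c d‖ := norm_sub_le _ _
      _ ≤ (1 + ‖π‖) * ‖d‖ := by linarith
      _ ≤ _ := by gcongr

/-- **Cohen factorization** for a bounded action `π` of a C⋆-algebra on a Banach space which is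
multiplicative on commuting pairs (so that left and right actions are both covered). -/
theorem CStarAlgebra.exists_apply_eq_of_approx [CompleteSpace X] (π : A →L[ℂ] X →L[ℂ] X)
    (hmul : ∀ a c, Commute a c → π (a * c) = π a ∘L π c)
    (happrox : ∀ x : X, ∀ ε > 0, ∃ e : A, 0 ≤ e ∧ ‖e‖ ≤ 1 ∧ ‖x - π e x‖ ≤ ε)
    (E : Submodule ℂ X) (hE : IsClosed (E : Set X)) (hEπ : ∀ a, ∀ x ∈ E, π a x ∈ E)
    {x : X} (hx : x ∈ E) : ∃ a, ∃ y ∈ E, π a y = x := by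
  let P (n : ℕ) (p : A × X) : Prop :=
    0 ≤ p.1 ∧ p.2 ∈ E ∧ (((1 / 2 : ℝ) ^ n : ℝ) : ℂ) • p.2 + π p.1 p.2 = x
  have step (n : ℕ) (p : {p // P n p}) : ∃ q : {q // P (n + 1) q},
      dist p.1.1 q.1.1 ≤ 1 * (1 / 2 : ℝ) ^ n ∧
        dist p.1.2 q.1.2 ≤ (1 + ‖π‖) * (1 / 2 : ℝ) ^ n := by
    obtain ⟨⟨a, y⟩, ha, hy, hxy⟩ := p
    obtain ⟨b, z, hb, hz, hbz, hab, hyz⟩ := CStarAlgebra.exists_smul_add_apply_eq π hmul happrox E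
      hEπ ha hy (t := (1 / 2 : ℝ) ^ (n + 1)) (by positivity) (x := x)
      (by rw [← hxy]; congr 2; push_cast; ring) (δ := (1 / 2 : ℝ) ^ n) (by positivity)
    refine ⟨⟨(b, z), hb, hz, hbz⟩, ?_, ?_⟩
    · rw [dist_comm, dist_eq_norm]
      refine hab.trans ?_
      rw [pow_succ]
      linarith [show (0 : ℝ) < (1 / 2) ^ n by positivity]
    · rwa [dist_comm, dist_eq_norm]
  choose next hnext₁ hnext₂ using step
  let s (n : ℕ) : {p // P n p} := n.rec ⟨(0, x), le_rfl, hx, by simp⟩ next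
  obtain ⟨a, ha⟩ := cauchySeq_tendsto_of_complete
    (cauchySeq_of_le_geometric (1 / 2) 1 (by norm_num) fun n ↦ hnext₁ n (s n))
  obtain ⟨y, hy⟩ := cauchySeq_tendsto_of_complete
    (cauchySeq_of_le_geometric (1 / 2) (1 + ‖π‖) (by norm_num) fun n ↦ hnext₂ n (s n))
  replace ha : Tendsto (fun n ↦ (s n).1.1) atTop (𝓝 a) := ha
  replace hy : Tendsto (fun n ↦ (s n).1.2) atTop (𝓝 y) := hy
  refine ⟨a, y, hE.mem_of_tendsto hy (.of_forall fun n ↦ (s n).2.2.1), ?_⟩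
  have hpow : Tendsto (fun n : ℕ ↦ (((1 / 2 : ℝ) ^ n : ℝ) : ℂ)) atTop (𝓝 0) := by
    rw [← Complex.ofReal_zero]
    exact (Complex.continuous_ofReal.tendsto 0).comp
      (tendsto_pow_atTop_nhds_zero_of_lt_one (by norm_num) (by norm_num))
  have hπ : Tendsto (fun n ↦ π (s n).1.1 (s n).1.2) atTop (𝓝 (π a y)) :=
    (π.continuous₂.tendsto (a, y)).comp (ha.prodMk_nhds hy)
  have hlim := (hpow.smul hy).add hπ
  rw [zero_smul, zero_add] at hlim
  exact tendsto_nhds_unique hlim (tendsto_const_nhds.congr fun n ↦ (s n).2.2.2.symm)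

end CohenFactorization

section DualEssential

lemma exists_norm_eq_one_norm_add_mul (a b : ℂ) : ∃ c : ℂ, ‖c‖ = 1 ∧ ‖a + c * b‖ = ‖a‖ + ‖b‖ := by
  obtain ⟨u, hu, hua : (‖a‖ : ℂ) = u * a⟩ := RCLike.exists_norm_eq_mul_self a
  obtain ⟨v, hv, hvb : (‖b‖ : ℂ) = v * b⟩ := RCLike.exists_norm_eq_mul_self b
  have hu0 : u ≠ 0 := norm_ne_zero_iff.mp (by simp [hu])
  refine ⟨u⁻¹ * v, by simp [hu, hv], ?_⟩
  calc ‖a + u⁻¹ * v * b‖ = ‖u * (a + u⁻¹ * v * b)‖ := by rw [norm_mul, hu, one_mul]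
    _ = ‖((‖a‖ + ‖b‖ : ℝ) : ℂ)‖ := by
      congr 1
      push_cast
      rw [hua, hvb]
      field_simp
    _ = ‖a‖ + ‖b‖ := by
      rw [Complex.norm_real, Real.norm_of_nonneg (by positivity)]

/-- A functional almost attaining its norm at `x` is almost zero on the range of any operator `P`
whose values are approximately orthogonal to `x`. -/
lemma ContinuousLinearMap.exists_norm_comp_le {X : Type*} [NormedAddCommGroup X] [NormedSpace ℂ X]
    (f : X →L[ℂ] ℂ) {ε : ℝ} (hε : 0 < ε) : ∃ x : X, ∃ η > 0, ‖x‖ ≤ 1 ∧ ∀ P : X →L[ℂ] X,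
      (∀ y, ‖x + P y‖ ^ 2 ≤ 1 + 2 * (η * ‖y‖) + 4 * ‖y‖ ^ 2) → ‖f ∘L P‖ ≤ ε := by
  set N := ‖f‖
  have hN : 0 ≤ N := norm_nonneg f
  set l := ε / (4 * (N + 1)) with hl
  have hl0 : 0 < l := by positivity
  have hlN : l * N ≤ ε / 4 := by
    rw [hl, div_mul_eq_mul_div, div_le_div_iff₀ (by positivity) (by positivity)]
    nlinarith
  obtain ⟨x, hx, hfx⟩ := f.exists_lt_apply_of_lt_opNorm (r := N - l * ε / 4)
    (sub_lt_self _ (by positivity))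
  refine ⟨x, l, hl0, hx.le, fun P hP ↦ ContinuousLinearMap.opNorm_le_of_unit_norm hε.le fun y hy ↦ ?_⟩
  obtain ⟨c, hc, hcf⟩ := exists_norm_eq_one_norm_add_mul (f x) (f (P ((l : ℂ) • y)))
  have hPy := hP ((c * l) • y)
  have hnorm : ‖(c * l : ℂ) • y‖ = l := by simp [norm_smul, hc, hy, abs_of_pos hl0]
  rw [hnorm] at hPy
  have hle : ‖x + P ((c * l : ℂ) • y)‖ ≤ 1 + 3 * l ^ 2 :=
    abs_le_of_sq_le_sq' (by nlinarith [sq_nonneg (l ^ 2)]) (by positivity) |>.2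
  have hf : ‖f x‖ + l * ‖f (P y)‖ ≤ N * (1 + 3 * l ^ 2) := by
    calc ‖f x‖ + l * ‖f (P y)‖ = ‖f (x + P ((c * l : ℂ) • y))‖ := by
          rw [map_add, mul_smul, map_smul P, map_smul f, smul_eq_mul, hcf]
          simp [abs_of_pos hl0]
      _ ≤ N * (1 + 3 * l ^ 2) := f.le_of_opNorm_le_of_le le_rfl hle
  have hmul : l * ‖f (P y)‖ ≤ l * ε := by nlinarith
  exact le_of_mul_le_mul_left hmul hl0

variable {A : Type*} [NonUnitalCStarAlgebra A]

lemma CStarRing.sq_norm_add_le_star_mul (x w : A) :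
    ‖x + w‖ ^ 2 ≤ ‖x‖ ^ 2 + 2 * ‖star x * w‖ + ‖w‖ ^ 2 := by
  have h : ‖star w * x‖ = ‖star x * w‖ := by rw [← norm_star, star_mul, star_star]
  calc ‖x + w‖ ^ 2 = ‖star x * x + star x * w + (star w * x + star w * w)‖ := by
        rw [sq, ← CStarRing.norm_star_mul_self, star_add, add_mul, mul_add, mul_add]
    _ ≤ ‖star x * x‖ + ‖star x * w‖ + (‖star w * x‖ + ‖star w * w‖) :=
        (norm_add_le _ _).trans (add_le_add (norm_add_le _ _) (norm_add_le _ _))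
    _ = _ := by
        rw [CStarRing.norm_star_mul_self, CStarRing.norm_star_mul_self, h]
        ring

lemma CStarRing.sq_norm_add_le_mul_star (x w : A) :
    ‖x + w‖ ^ 2 ≤ ‖x‖ ^ 2 + 2 * ‖x * star w‖ + ‖w‖ ^ 2 := by
  simpa [← star_add, norm_star] using CStarRing.sq_norm_add_le_star_mul (star x) (star w)

variable [PartialOrder A] [StarOrderedRing A]

/-- The dual of a C⋆-algebra is essential for the action `(a, f) ↦ f (· * a)`. -/
lemma CStarAlgebra.exists_norm_sub_comp_flip_mul_le (f : A →L[ℂ] ℂ) {ε : ℝ} (hε : 0 < ε) :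
    ∃ e : A, 0 ≤ e ∧ ‖e‖ ≤ 1 ∧ ‖f - f ∘L (ContinuousLinearMap.mul ℂ A).flip e‖ ≤ ε := by
  obtain ⟨x, η, hη, hx1, hx⟩ := f.exists_norm_comp_le hε
  have hl := CStarAlgebra.increasingApproximateUnit A
  have hnhds : ∀ᶠ e in CStarAlgebra.approximateUnit A, ‖x - x * e‖ < η := by
    filter_upwards [(hl.tendsto_mul_left x).eventually (Metric.ball_mem_nhds x hη)] with e he
    rwa [← dist_eq_norm, dist_comm]
  obtain ⟨e, he, he1, hxe⟩ := (hl.eventually_nonneg.and (hl.eventually_norm.and hnhds)).exists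
  refine ⟨e, he, he1, ?_⟩
  convert hx (.id ℂ A - (ContinuousLinearMap.mul ℂ A).flip e) fun y ↦ ?_ using 2
  · ext y
    simp
  · have hcross : x * star (y - y * e) = (x - x * e) * star y := by
      rw [star_sub, star_mul, (IsSelfAdjoint.of_nonneg he).star_eq, mul_sub, sub_mul, mul_assoc]
    have h1 : ‖x * star (y - y * e)‖ ≤ η * ‖y‖ := by
      rw [hcross, ← norm_star y]
      exact (norm_mul_le _ _).trans (by gcongr)
    have h2 : ‖y - y * e‖ ≤ 2 * ‖y‖ := by
      have := (norm_mul_le y e).trans (mul_le_of_le_one_right (norm_nonneg y) he1)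
      linarith [norm_sub_le y (y * e)]
    have h3 := CStarRing.sq_norm_add_le_mul_star x (y - y * e)
    simp only [_root_.sub_apply, ContinuousLinearMap.id_apply,
      ContinuousLinearMap.flip_apply, ContinuousLinearMap.mul_apply']
    nlinarith [norm_nonneg x, norm_nonneg (y - y * e), norm_nonneg y]

/-- The dual of a C⋆-algebra is essential for the action `(a, f) ↦ f (a * ·)`. -/
lemma CStarAlgebra.exists_norm_sub_comp_mul_le (f : A →L[ℂ] ℂ) {ε : ℝ} (hε : 0 < ε) :
    ∃ e : A, 0 ≤ e ∧ ‖e‖ ≤ 1 ∧ ‖f - f ∘L ContinuousLinearMap.mul ℂ A e‖ ≤ ε := by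
  obtain ⟨x, η, hη, hx1, hx⟩ := f.exists_norm_comp_le hε
  have hl := CStarAlgebra.increasingApproximateUnit A
  have hnhds : ∀ᶠ e in CStarAlgebra.approximateUnit A, ‖x - e * x‖ < η := by
    filter_upwards [(hl.tendsto_mul_right x).eventually (Metric.ball_mem_nhds x hη)] with e he
    rwa [← dist_eq_norm, dist_comm]
  obtain ⟨e, he, he1, hxe⟩ := (hl.eventually_nonneg.and (hl.eventually_norm.and hnhds)).exists
  refine ⟨e, he, he1, ?_⟩
  convert hx (.id ℂ A - ContinuousLinearMap.mul ℂ A e) fun y ↦ ?_ using 2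
  · ext y
    simp
  · have hcross : star x * (y - e * y) = star (x - e * x) * y := by
      rw [star_sub, star_mul, (IsSelfAdjoint.of_nonneg he).star_eq, mul_sub, sub_mul, mul_assoc]
    have h1 : ‖star x * (y - e * y)‖ ≤ η * ‖y‖ := by
      rw [hcross]
      refine (norm_mul_le _ _).trans ?_
      rw [norm_star]
      gcongr
    have h2 : ‖y - e * y‖ ≤ 2 * ‖y‖ := by
      have := (norm_mul_le e y).trans (mul_le_of_le_one_left (norm_nonneg y) he1)
      linarith [norm_sub_le y (e * y)]
    have h3 := CStarRing.sq_norm_add_le_star_mul x (y - e * y)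
    simp only [_root_.sub_apply, ContinuousLinearMap.id_apply,
      ContinuousLinearMap.mul_apply']
    nlinarith [norm_nonneg x, norm_nonneg (y - e * y), norm_nonneg y]

end DualEssential


/-- **Factorization in closed submodules of the dual of a C*-algebra.**
Let `A` be a (not necessarily unital) C*-algebra and let `E` be a norm-closed linear
subspace of the continuous dual `A →L[ℂ] ℂ` that is a sub-bimodule for the natural dual
actions, i.e., for every `a ∈ A` and `f ∈ E` the functionals `a·f : x ↦ f (x * a)` and
`f·a : x ↦ f (a * x)` again lie in `E`.  Then
`E = { a·f·b : a, b ∈ A, f ∈ E } = { h | ∃ a b, ∃ g ∈ E, ∀ x, h x = g (b * x * a) }`. -/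
theorem closed_dual_submodule_factorization
    {A : Type*} [NonUnitalNormedRing A] [StarRing A] [CStarRing A]
    [NormedSpace ℂ A] [IsScalarTower ℂ A A] [SMulCommClass ℂ A A]
    [StarModule ℂ A] [CompleteSpace A]
    (E : Submodule ℂ (A →L[ℂ] ℂ)) (hE : IsClosed (E : Set (A →L[ℂ] ℂ)))
    (hleft : ∀ a : A, ∀ f ∈ E, ∃ g ∈ E, ∀ x : A, g x = f (x * a))
    (hright : ∀ a : A, ∀ f ∈ E, ∃ g ∈ E, ∀ x : A, g x = f (a * x)) :
    (E : Set (A →L[ℂ] ℂ)) =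
      {h : A →L[ℂ] ℂ | ∃ a b : A, ∃ g ∈ E, ∀ x : A, h x = g (b * x * a)} := by
  let _ : NonUnitalCStarAlgebra A := { }
  let _ : PartialOrder A := CStarAlgebra.spectralOrder A
  have : StarOrderedRing A := CStarAlgebra.spectralOrderedRing A
  let comp := (ContinuousLinearMap.compL ℂ A A ℂ).flip
  let L : A →L[ℂ] (A →L[ℂ] ℂ) →L[ℂ] (A →L[ℂ] ℂ) := comp ∘L (ContinuousLinearMap.mul ℂ A).flip
  let R : A →L[ℂ] (A →L[ℂ] ℂ) →L[ℂ] (A →L[ℂ] ℂ) := comp ∘L ContinuousLinearMap.mul ℂ A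
  have hL (a : A) (f : A →L[ℂ] ℂ) (x : A) : L a f x = f (x * a) := rfl
  have hR (a : A) (f : A →L[ℂ] ℂ) (x : A) : R a f x = f (a * x) := rfl
  have hLE (a : A) (f) (hf : f ∈ E) : L a f ∈ E := by
    obtain ⟨g, hg, hgf⟩ := hleft a f hf
    rwa [show L a f = g from ContinuousLinearMap.ext fun x ↦ (hgf x).symm]
  have hRE (a : A) (f) (hf : f ∈ E) : R a f ∈ E := by
    obtain ⟨g, hg, hgf⟩ := hright a f hf
    rwa [show R a f = g from ContinuousLinearMap.ext fun x ↦ (hgf x).symm]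
  ext h
  constructor
  · intro hh
    obtain ⟨a, f, hf, rfl⟩ := CStarAlgebra.exists_apply_eq_of_approx L
      (fun a c _ ↦ by ext f x; simp [hL, mul_assoc])
      (fun f _ hε ↦ CStarAlgebra.exists_norm_sub_comp_flip_mul_le f hε) E hE hLE hh
    obtain ⟨b, g, hg, rfl⟩ := CStarAlgebra.exists_apply_eq_of_approx R
      (fun a c hac ↦ by ext f x; simp [hR, hac.eq, mul_assoc])
      (fun f _ hε ↦ CStarAlgebra.exists_norm_sub_comp_mul_le f hε) E hE hRE hf
    exact ⟨a, b, g, hg, fun x ↦ by rw [hL, hR, mul_assoc]⟩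
  · rintro ⟨a, b, g, hg, hx⟩
    rw [show h = L a (R b g) from ContinuousLinearMap.ext fun x ↦ by rw [hx, hL, hR, mul_assoc]]
    exact hLE _ _ (hRE _ _ hg)
end

section
/- Let A be a C*-algebra and let E be a norm-closed linear subspace of the continuous dual space A* that is invariant under the left dual action, i.e., a·f ∈ E for every a ∈ A and f ∈ E, where (a·f)(x) = f(xa) for x ∈ A. Then every element of E factors through this action: for every f ∈ E there exist a ∈ A and g ∈ E such that f(x) = g(xa) for all x ∈ A. -/
open Filter Topology

section ApproximateUnit

variable {A : Type*} [NonUnitalCStarAlgebra A]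

lemma norm_add_smul_sub_mul_le {x y e : A} {t : ℝ} (ht : 0 ≤ t) (he : IsSelfAdjoint e)
    (he1 : ‖e‖ ≤ 1) (hx : ‖x‖ ≤ 1) (hy : ‖y‖ ≤ 1) (hxe : ‖x - x * e‖ ≤ t) :
    ‖x + (t : ℂ) • (y - y * e)‖ ≤ 1 + 3 * t ^ 2 := by
  set z := y - y * e with hz
  have hz2 : ‖z‖ ≤ 2 := by
    calc ‖z‖ ≤ ‖y‖ + ‖y * e‖ := norm_sub_le _ _
      _ ≤ 1 + 1 * 1 := by
        gcongr
        exact (norm_mul_le _ _).trans (by gcongr)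
      _ = 2 := by norm_num
  have hxz : ‖x * star z‖ ≤ t := by
    have : x * star z = (x - x * e) * star y := by
      simp [hz, he.star_eq, mul_sub, sub_mul, mul_assoc]
    rw [this]
    calc _ ≤ ‖x - x * e‖ * ‖star y‖ := norm_mul_le _ _
      _ ≤ t * 1 := by
        rw [norm_star]
        gcongr
      _ = t := mul_one t
  have hzx : ‖z * star x‖ ≤ t := by
    rw [← norm_star]
    simpa using hxz
  have hexp : (x + (t : ℂ) • z) * star (x + (t : ℂ) • z) =
      x * star x + (t : ℂ) • (x * star z) + (t : ℂ) • (z * star x)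
        + ((t : ℂ) * t) • (z * star z) := by
    simp only [star_add, star_smul, add_mul, mul_add, smul_mul_assoc, mul_smul_comm,
      Complex.star_def, Complex.conj_ofReal]
    module
  have hsq : ‖x + (t : ℂ) • z‖ * ‖x + (t : ℂ) • z‖ ≤ 1 + 6 * t ^ 2 := by
    rw [← CStarRing.norm_self_mul_star, hexp]
    have h4 : ‖((t : ℂ) * t) • (z * star z)‖ ≤ t * t * (2 * 2) := by
      rw [norm_smul, CStarRing.norm_self_mul_star, norm_mul, Complex.norm_real,
        Real.norm_of_nonneg ht]
      gcongr
    have h2 : ‖(t : ℂ) • (x * star z)‖ ≤ t * t := by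
      rw [norm_smul, Complex.norm_real, Real.norm_of_nonneg ht]
      gcongr
    have h3 : ‖(t : ℂ) • (z * star x)‖ ≤ t * t := by
      rw [norm_smul, Complex.norm_real, Real.norm_of_nonneg ht]
      gcongr
    have h1 : ‖x * star x‖ ≤ 1 * 1 := by
      rw [CStarRing.norm_self_mul_star]
      gcongr
    refine norm_add₄_le.trans ?_
    linarith
  nlinarith [norm_nonneg (x + (t : ℂ) • z), sq_nonneg (t ^ 2)]

lemma norm_apply_sub_mul_le (f : A →L[ℂ] ℂ) {x y e : A} {t : ℝ} (ht : 0 < t)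
    (he : IsSelfAdjoint e) (he1 : ‖e‖ ≤ 1) (hx : ‖x‖ ≤ 1) (hy : ‖y‖ ≤ 1)
    (hxe : ‖x - x * e‖ ≤ t) (hfx : ‖f‖ - t ^ 2 ≤ ‖f x‖) :
    ‖f (y - y * e)‖ ≤ t * (3 * ‖f‖ + 1) := by
  obtain ⟨c, hc, hcx⟩ := Complex.exists_norm_eq_mul_self (f x)
  obtain ⟨d, hd, hdy⟩ := Complex.exists_norm_eq_mul_self (f (y - y * e))
  have hn := norm_add_smul_sub_mul_le (x := c • x) (y := d • y) ht.le he he1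
    (by rwa [norm_smul, hc, one_mul]) (by rwa [norm_smul, hd, one_mul])
    (by rwa [smul_mul_assoc, ← smul_sub, norm_smul, hc, one_mul])
  have hf : f (c • x + (t : ℂ) • (d • y - d • y * e)) =
      ((‖f x‖ + t * ‖f (y - y * e)‖ : ℝ) : ℂ) := by
    rw [smul_mul_assoc, ← smul_sub, map_add, map_smul, map_smul, map_smul]
    simp only [smul_eq_mul, ← hcx, ← hdy]
    push_cast
    rfl
  have hle := f.le_opNorm_of_le hn
  rw [hf, Complex.norm_real, Real.norm_of_nonneg (by positivity)] at hle
  have : t * ‖f (y - y * e)‖ ≤ t * (t * (3 * ‖f‖ + 1)) := by nlinarith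
  exact le_of_mul_le_mul_left this ht

/-- The left action `a • f = fun x ↦ f (x * a)` of `A` on its dual. -/
noncomputable def dualLeftAction (A : Type*) [NonUnitalCStarAlgebra A] :
    A →L[ℂ] (A →L[ℂ] ℂ) →L[ℂ] (A →L[ℂ] ℂ) :=
  (ContinuousLinearMap.compL ℂ A A ℂ).flip.comp (ContinuousLinearMap.mul ℂ A).flip

@[simp]
lemma dualLeftAction_apply (a x : A) (f : A →L[ℂ] ℂ) : dualLeftAction A a f x = f (x * a) := rfl

lemma exists_norm_sub_dualLeftAction_le [PartialOrder A] [StarOrderedRing A]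
    (f : A →L[ℂ] ℂ) {ε : ℝ} (hε : 0 < ε) :
    ∃ e : A, 0 ≤ e ∧ ‖e‖ ≤ 1 ∧ ‖f - dualLeftAction A e f‖ ≤ ε := by
  set t := ε / (3 * ‖f‖ + 1) with ht_def
  have hM : 0 < 3 * ‖f‖ + 1 := by positivity
  have ht : 0 < t := by positivity
  obtain ⟨x, hx, hfx⟩ := f.exists_lt_apply_of_lt_opNorm (r := ‖f‖ - t ^ 2) (by nlinarith)
  have hl := CStarAlgebra.increasingApproximateUnit A
  have hxe : ∀ᶠ e in CStarAlgebra.approximateUnit A, ‖x - x * e‖ ≤ t := by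
    filter_upwards [(hl.tendsto_mul_left x).eventually (Metric.closedBall_mem_nhds x ht)] with e h
    rwa [← dist_eq_norm, dist_comm]
  obtain ⟨e, he0, he1, he⟩ := (hl.eventually_nonneg.and (hl.eventually_norm.and hxe)).exists
  refine ⟨e, he0, he1, ContinuousLinearMap.opNorm_le_of_unit_norm hε.le fun y hy ↦ ?_⟩
  have := norm_apply_sub_mul_le f ht he0.isSelfAdjoint he1 hx.le hy.le he hfx.le
  rw [ht_def, div_mul_cancel₀ _ hM.ne', map_sub] at this
  simpa using this

lemma exists_resolvent_of_nonneg [PartialOrder A] [StarOrderedRing A] {b : A} (hb : 0 ≤ b)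
    {s : ℝ} (hs : 0 < s) :
    ∃ c : A, ‖c‖ ≤ 1 ∧ b * c + (s : ℂ) • c = b ∧ c * b + (s : ℂ) • c = b := by
  have hspec : ∀ x ∈ quasispectrum ℝ b, 0 ≤ x := fun x hx ↦ quasispectrum_nonneg_of_nonneg b hb x hx
  have hpos : ∀ x ∈ quasispectrum ℝ b, x + s ≠ 0 := fun x hx ↦ by
    have := hspec x hx
    positivity
  have hcont : ContinuousOn (fun x : ℝ ↦ x / (x + s)) (quasispectrum ℝ b) := by
    fun_prop (disch := assumption)
  have hsa : IsSelfAdjoint b := hb.isSelfAdjoint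
  have hcomm : b * cfcₙ (fun x : ℝ ↦ x / (x + s)) b = cfcₙ (fun x : ℝ ↦ x / (x + s)) b * b := by
    have := cfcₙ_commute_cfcₙ (fun x : ℝ ↦ x) (fun x : ℝ ↦ x / (x + s)) b
    rw [cfcₙ_id' ℝ b] at this
    exact this
  have hres : b * cfcₙ (fun x : ℝ ↦ x / (x + s)) b
      + (s : ℂ) • cfcₙ (fun x : ℝ ↦ x / (x + s)) b = b := by
    rw [Complex.coe_smul]
    nth_rw 1 [← cfcₙ_id' ℝ b]
    rw [← cfcₙ_mul (fun x : ℝ ↦ x) _ b, ← cfcₙ_smul s _ b, ← cfcₙ_add _ _ b]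
    conv_rhs => rw [← cfcₙ_id' ℝ b]
    refine cfcₙ_congr fun x hx ↦ ?_
    have := hpos x hx
    simp only [smul_eq_mul]
    field_simp
  refine ⟨cfcₙ (fun x : ℝ ↦ x / (x + s)) b, norm_cfcₙ_le fun x hx ↦ ?_, hres, hcomm ▸ hres⟩
  have := hspec x hx
  rw [Real.norm_of_nonneg (by positivity)]
  exact div_le_one_of_le₀ (by linarith) (by positivity)

end ApproximateUnit

section Factorization

variable {A X : Type*} [NonUnitalCStarAlgebra A] [PartialOrder A] [StarOrderedRing A]
  [NormedAddCommGroup X] [NormedSpace ℂ X] {π : A →L[ℂ] X →L[ℂ] X}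

lemma exists_mem_apply_add_smul_eq (hπ : ∀ a b x, π (a * b) x = π a (π b x))
    {E : Submodule ℂ X} (hE : ∀ a, ∀ x ∈ E, π a x ∈ E) {b : A} (hb : 0 ≤ b) {s : ℝ} (hs : 0 < s)
    {h : X} (hh : h ∈ E) :
    ∃ g ∈ E, π b g + (s : ℂ) • g = h := by
  obtain ⟨c, -, hc, -⟩ := exists_resolvent_of_nonneg hb hs
  have hs' : (s : ℂ) ≠ 0 := by exact_mod_cast hs.ne'
  refine ⟨(s : ℂ)⁻¹ • (h - π c h), E.smul_mem _ (E.sub_mem hh (hE c h hh)), ?_⟩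
  have hbc : π b (π c h) + (s : ℂ) • π c h = π b h := by
    simpa [hπ] using congrArg (fun a ↦ π a h) hc
  rw [smul_inv_smul₀ hs', map_smul, map_sub, ← hbc, add_sub_cancel_left, inv_smul_smul₀ hs',
    add_sub_cancel]

lemma norm_le_of_apply_add_smul_eq (hπ : ∀ a b x, π (a * b) x = π a (π b x))
    {b : A} (hb : 0 ≤ b) {s : ℝ} (hs : 0 < s) {g h : X} (hg : π b g + (s : ℂ) • g = h) :
    s * ‖g‖ ≤ (1 + ‖π‖) * ‖h‖ := by
  obtain ⟨c, hc1, -, hc⟩ := exists_resolvent_of_nonneg hb hs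
  have hcb : π c (π b g) + (s : ℂ) • π c g = π b g := by
    simpa [hπ] using congrArg (fun a ↦ π a g) hc
  have key : (s : ℂ) • g = h - π c h := by
    rw [← hg, map_add, map_smul, hcb, add_sub_cancel_left]
  calc s * ‖g‖ = ‖(s : ℂ) • g‖ := by
        rw [norm_smul, Complex.norm_real, Real.norm_of_nonneg hs.le]
    _ = ‖h - π c h‖ := by rw [key]
    _ ≤ ‖h‖ + ‖π c h‖ := norm_sub_le _ _
    _ ≤ ‖h‖ + ‖π‖ * 1 * ‖h‖ := by
        gcongr
        exact (π.le_opNorm₂ c h).trans (by gcongr)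
    _ = (1 + ‖π‖) * ‖h‖ := by ring

lemma exists_factorization_step (hπ : ∀ a b x, π (a * b) x = π a (π b x))
    {E : Submodule ℂ X} (hE : ∀ a, ∀ x ∈ E, π a x ∈ E)
    (happrox : ∀ x ∈ E, ∀ ε > 0, ∃ e : A, 0 ≤ e ∧ ‖e‖ ≤ 1 ∧ ‖x - π e x‖ ≤ ε)
    {f g : X} (hf : f ∈ E) (hg : g ∈ E) {b : A} (hb : 0 ≤ b) {s δ : ℝ} (hs : 0 < s) (hδ : 0 < δ)
    (hbg : π b g + ((2 * s : ℝ) : ℂ) • g = f) :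
    ∃ b' : A, ∃ g' ∈ E, 0 ≤ b' ∧ π b' g' + (s : ℂ) • g' = f ∧ ‖b - b'‖ ≤ s ∧ ‖g - g'‖ ≤ δ := by
  have hC : 0 < 1 + ‖π‖ := by positivity
  obtain ⟨e, he0, he1, he⟩ := happrox g hg (δ / (1 + ‖π‖)) (by positivity)
  have hb' : 0 ≤ b + (s : ℂ) • e :=
    add_nonneg hb (by rw [Complex.coe_smul]; exact smul_nonneg hs.le he0)
  obtain ⟨g', hg', hgf⟩ := exists_mem_apply_add_smul_eq hπ hE hb' hs hf
  refine ⟨b + (s : ℂ) • e, g', hg', hb', hgf, ?_, ?_⟩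
  · rw [sub_add_cancel_left, norm_neg, norm_smul, Complex.norm_real, Real.norm_of_nonneg hs.le]
    exact mul_le_of_le_one_right hs.le he1
  · have hdiff : π (b + (s : ℂ) • e) (g' - g) + (s : ℂ) • (g' - g) = (s : ℂ) • (g - π e g) := by
      rw [map_sub, smul_sub, sub_add_sub_comm, hgf, ← hbg]
      simp only [map_add, map_smul, add_apply, smul_apply]
      push_cast
      module
    have hle := norm_le_of_apply_add_smul_eq hπ hb' hs hdiff
    rw [norm_smul, Complex.norm_real, Real.norm_of_nonneg hs.le, mul_left_comm] at hle
    rw [norm_sub_rev]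
    refine (le_of_mul_le_mul_left hle hs).trans ?_
    rwa [le_div_iff₀' hC] at he

/-- **Cohen factorization** in a closed submodule on which a C⋆-algebra acts nondegenerately. -/
theorem exists_mem_eq_apply_of_approximateUnit [CompleteSpace X]
    (hπ : ∀ a b x, π (a * b) x = π a (π b x))
    {E : Submodule ℂ X} (hclosed : IsClosed (E : Set X)) (hE : ∀ a, ∀ x ∈ E, π a x ∈ E)
    (happrox : ∀ x ∈ E, ∀ ε > 0, ∃ e : A, 0 ≤ e ∧ ‖e‖ ≤ 1 ∧ ‖x - π e x‖ ≤ ε)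
    {f : X} (hf : f ∈ E) :
    ∃ a : A, ∃ g ∈ E, f = π a g := by
  let P (n : ℕ) (p : A × X) : Prop :=
    0 ≤ p.1 ∧ p.2 ∈ E ∧ π p.1 p.2 + (((1 / 2) ^ n : ℝ) : ℂ) • p.2 = f
  have hstep (n : ℕ) (p : {p // P n p}) : ∃ q : {q // P (n + 1) q},
      ‖p.1.1 - q.1.1‖ ≤ 1 / 2 * (1 / 2) ^ n ∧ ‖p.1.2 - q.1.2‖ ≤ 1 * (1 / 2) ^ n := by
    obtain ⟨⟨b, g⟩, hb, hg, hbg⟩ := p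
    obtain ⟨b', g', hg', hb', hbg', h1, h2⟩ := exists_factorization_step hπ hE happrox hf hg hb
      (s := (1 / 2) ^ (n + 1)) (δ := 1 * (1 / 2) ^ n) (by positivity) (by positivity)
      (by rw [← hbg]; congr 3; ring)
    exact ⟨⟨⟨b', g'⟩, hb', hg', hbg'⟩, h1.trans_eq (pow_succ' _ _), h2⟩
  choose next hnext using hstep
  let u : ∀ n, {p // P n p} := fun n ↦ Nat.rec ⟨(0, f), le_rfl, hf, by simp⟩ next n
  have hu (n : ℕ) : u (n + 1) = next n (u n) := rfl
  obtain ⟨a, ha⟩ := cauchySeq_tendsto_of_complete <|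
    cauchySeq_of_le_geometric (1 / 2) (1 / 2) (by norm_num) (f := fun n ↦ (u n).1.1) fun n ↦ by
      rw [dist_eq_norm, hu]
      exact (hnext n (u n)).1
  obtain ⟨g, hg⟩ := cauchySeq_tendsto_of_complete <|
    cauchySeq_of_le_geometric (1 / 2) 1 (by norm_num) (f := fun n ↦ (u n).1.2) fun n ↦ by
      rw [dist_eq_norm, hu]
      exact (hnext n (u n)).2
  refine ⟨a, g, hclosed.mem_of_tendsto hg (.of_forall fun n ↦ (u n).2.2.1), ?_⟩
  have hpow : Tendsto (fun n : ℕ ↦ (((1 / 2) ^ n : ℝ) : ℂ)) atTop (𝓝 0) := by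
    have := tendsto_pow_atTop_nhds_zero_of_lt_one (r := (1 / 2 : ℝ)) (by norm_num) (by norm_num)
    exact_mod_cast (Complex.continuous_ofReal.tendsto 0).comp this
  have hlim : Tendsto (fun n ↦ π (u n).1.1 (u n).1.2 + (((1 / 2) ^ n : ℝ) : ℂ) • (u n).1.2) atTop
      (𝓝 (π a g + (0 : ℂ) • g)) :=
    ((π.continuous₂.tendsto (a, g)).comp (ha.prodMk_nhds hg)).add (hpow.smul hg)
  simp only [fun n ↦ (u n).2.2.2, zero_smul, add_zero] at hlim
  exact tendsto_nhds_unique tendsto_const_nhds hlim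

end Factorization

/-- **One-sided factorization in closed left-invariant subspaces of the dual of a
C*-algebra.**  Let `A` be a (not necessarily unital) C*-algebra and let `E` be a
norm-closed linear subspace of the continuous dual `A →L[ℂ] ℂ` that is invariant under
the left dual action, i.e., for every `a ∈ A` and `f ∈ E` the functional
`a·f : x ↦ f (x * a)` again lies in `E`.  Then every element of `E` factors through this
action: for every `f ∈ E` there are `a ∈ A` and `g ∈ E` with `f x = g (x * a)` for all
`x`. -/
theorem closed_dual_left_submodule_factorization
    {A : Type*} [NonUnitalNormedRing A] [StarRing A] [CStarRing A]
    [NormedSpace ℂ A] [IsScalarTower ℂ A A] [SMulCommClass ℂ A A]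
    [StarModule ℂ A] [CompleteSpace A]
    (E : Submodule ℂ (A →L[ℂ] ℂ)) (hE : IsClosed (E : Set (A →L[ℂ] ℂ)))
    (hleft : ∀ a : A, ∀ f ∈ E, ∃ g ∈ E, ∀ x : A, g x = f (x * a)) :
    ∀ f ∈ E, ∃ a : A, ∃ g ∈ E, ∀ x : A, f x = g (x * a) := by
  intro f hf
  let _ : NonUnitalCStarAlgebra A := {}
  let _ : PartialOrder A := CStarAlgebra.spectralOrder A
  have : StarOrderedRing A := CStarAlgebra.spectralOrderedRing A
  have hinv : ∀ a, ∀ f ∈ E, dualLeftAction A a f ∈ E := fun a f hf ↦ by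
    obtain ⟨g, hg, hgf⟩ := hleft a f hf
    rwa [show dualLeftAction A a f = g from ContinuousLinearMap.ext fun x ↦ (hgf x).symm]
  obtain ⟨a, g, hg, rfl⟩ := exists_mem_eq_apply_of_approximateUnit (π := dualLeftAction A)
    (fun a b f ↦ ContinuousLinearMap.ext fun x ↦ by simp [mul_assoc]) hE hinv
    (fun f _ ε hε ↦ exists_norm_sub_dualLeftAction_le f hε) hf
  exact ⟨a, g, hg, fun _ ↦ rfl⟩
end

section
/- Let A be a C*-algebra and let f ∈ A*. Then f lies in the norm closure of the set { a·f : a ∈ A }, where (a·f)(x) = f(xa) for x ∈ A. -/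
theorem CStarRing.norm_add_sq_le {A : Type*} [NonUnitalNormedRing A] [StarRing A] [CStarRing A]
    (s z : A) : ‖s + z‖ ^ 2 ≤ ‖s‖ ^ 2 + 2 * ‖s * star z‖ + ‖z‖ ^ 2 := by
  have hstar : ‖z * star s‖ = ‖s * star z‖ := by
    rw [← norm_star, star_mul, star_star]
  have hexp : (s + z) * star (s + z) = s * star s + s * star z + z * star s + z * star z := by
    rw [star_add]
    noncomm_ring
  calc ‖s + z‖ ^ 2 = ‖(s + z) * star (s + z)‖ := by rw [CStarRing.norm_self_mul_star, sq]
    _ ≤ ‖s * star s‖ + ‖s * star z‖ + ‖z * star s‖ + ‖z * star z‖ := by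
      rw [hexp]
      exact norm_add₄_le
    _ = ‖s‖ ^ 2 + 2 * ‖s * star z‖ + ‖z‖ ^ 2 := by
      rw [CStarRing.norm_self_mul_star, CStarRing.norm_self_mul_star, hstar]
      ring

theorem NonUnitalCStarAlgebra.exists_isSelfAdjoint_norm_sub_mul_le {A : Type*}
    [NonUnitalCStarAlgebra A] (s : A) {ε : ℝ} (hε : 0 < ε) :
    ∃ e : A, IsSelfAdjoint e ∧ ‖e‖ ≤ 1 ∧ ‖s - s * e‖ ≤ ε := by
  let _ := CStarAlgebra.spectralOrder A
  let _ := CStarAlgebra.spectralOrderedRing A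
  have hl := CStarAlgebra.increasingApproximateUnit A
  have hclose : ∀ᶠ e in CStarAlgebra.approximateUnit A, ‖s - s * e‖ ≤ ε := by
    filter_upwards [hl.tendsto_mul_left s (Metric.closedBall_mem_nhds s hε)] with e he
    rw [← dist_eq_norm, dist_comm]
    exact he
  exact (hl.eventually_isSelfAdjoint.and (hl.eventually_norm.and hclose)).exists

theorem ContinuousLinearMap.exists_norm_le_one_lt_re {E : Type*} [NormedAddCommGroup E]
    [NormedSpace ℂ E] (g : E →L[ℂ] ℂ) {r : ℝ} (hr : r < ‖g‖) :
    ∃ x : E, ‖x‖ ≤ 1 ∧ r < (g x).re := by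
  obtain ⟨x, hx, hrx⟩ := g.exists_lt_apply_of_lt_opNorm hr
  obtain ⟨c, hc, hcx⟩ := Complex.exists_norm_eq_mul_self (g x)
  refine ⟨c • x, by rw [norm_smul, hc, one_mul]; exact hx.le, ?_⟩
  rw [map_smul, smul_eq_mul, ← hcx]
  simpa using hrx

/-- If `f` were at distance at least `δ` from every `e·f`, one could build sums `s` of `n` elements
of the form `x - x * e` with pairwise almost orthogonal right supports, so that `‖s‖ = O(√n)`
while `re (f s) ≥ n * δ`. -/
theorem NonUnitalCStarAlgebra.exists_norm_sub_comp_mul_lt {A : Type*} [NonUnitalCStarAlgebra A]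
    (f : A →L[ℂ] ℂ) {δ : ℝ} (hδ : 0 < δ) :
    ∃ e : A, ‖f - f ∘L (ContinuousLinearMap.mul ℂ A).flip e‖ < δ := by
  by_contra! hfar
  have hsum (n : ℕ) : ∃ s : A, ‖s‖ ^ 2 ≤ 6 * n ∧ n * (δ / 2) ≤ (f s).re := by
    induction n with
    | zero => exact ⟨0, by simp⟩
    | succ n ih =>
      obtain ⟨s, hs, hfs⟩ := ih
      obtain ⟨e, he, he1, hse⟩ := exists_isSelfAdjoint_norm_sub_mul_le s one_pos
      obtain ⟨x, hx, hfx⟩ := ContinuousLinearMap.exists_norm_le_one_lt_re _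
        ((half_lt_self hδ).trans_le (hfar e))
      have hfx' : δ / 2 < (f (x - x * e)).re := by simpa using hfx
      have hz : ‖x - x * e‖ ≤ 2 := by
        have := norm_sub_le x (x * e)
        have := norm_mul_le x e
        have := mul_le_one₀ hx (norm_nonneg e) he1
        linarith
      have hsz : ‖s * star (x - x * e)‖ ≤ 1 := by
        have heq : s * star (x - x * e) = (s - s * e) * star x := by
          rw [star_sub, star_mul, he.star_eq, mul_sub, sub_mul, mul_assoc]
        rw [heq]
        refine (norm_mul_le _ _).trans (mul_le_one₀ hse (norm_nonneg _) ?_)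
        rwa [norm_star]
      refine ⟨s + (x - x * e), ?_, ?_⟩
      · have := CStarRing.norm_add_sq_le s (x - x * e)
        have : ‖x - x * e‖ ^ 2 ≤ 2 ^ 2 := pow_le_pow_left₀ (norm_nonneg _) hz 2
        push_cast
        linarith
      · rw [map_add, Complex.add_re]
        push_cast
        linarith
  obtain ⟨n, hn⟩ := exists_nat_gt (6 * ‖f‖ ^ 2 / (δ / 2) ^ 2)
  rw [div_lt_iff₀ (by positivity)] at hn
  obtain ⟨s, hs, hfs⟩ := hsum n
  have hn0 : (0 : ℝ) < n := by
    by_contra! h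
    nlinarith [sq_nonneg ‖f‖, sq_nonneg (δ / 2)]
  have hle : n * (δ / 2) ≤ ‖f‖ * ‖s‖ :=
    hfs.trans ((Complex.re_le_norm _).trans (f.le_opNorm s))
  have hsq : (n * (δ / 2)) ^ 2 ≤ ‖f‖ ^ 2 * (6 * n) := calc
    (n * (δ / 2)) ^ 2 ≤ (‖f‖ * ‖s‖) ^ 2 := pow_le_pow_left₀ (by positivity) hle 2
    _ = ‖f‖ ^ 2 * ‖s‖ ^ 2 := mul_pow _ _ _
    _ ≤ ‖f‖ ^ 2 * (6 * n) := by gcongr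
  nlinarith [mul_lt_mul_of_pos_left hn hn0]

/-- Let `A` be a (not necessarily unital) C*-algebra and let `f` be a continuous linear
functional on `A`.  Then `f` lies in the norm closure of the set
`{ a·f : a ∈ A }`, where `(a·f) x = f (x * a)`. -/
theorem dual_functional_mem_closure_orbit
    {A : Type*} [NonUnitalNormedRing A] [StarRing A] [CStarRing A]
    [NormedSpace ℂ A] [IsScalarTower ℂ A A] [SMulCommClass ℂ A A]
    [StarModule ℂ A] [CompleteSpace A]
    (f : A →L[ℂ] ℂ) :
    f ∈ closure {h : A →L[ℂ] ℂ | ∃ a : A, ∀ x : A, h x = f (x * a)} := by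
  let _ : NonUnitalCStarAlgebra A := {}
  refine Metric.mem_closure_iff.mpr fun δ hδ ↦ ?_
  obtain ⟨e, he⟩ := NonUnitalCStarAlgebra.exists_norm_sub_comp_mul_lt f hδ
  exact ⟨f ∘L (ContinuousLinearMap.mul ℂ A).flip e, ⟨e, fun x ↦ rfl⟩, by rwa [dist_eq_norm]⟩
end
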